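/- (Eigenvectors of the linearized rotating MHD symbol) Let ε > 0, α ∈ ℝ and ξ = (ξ₁,ξ₂,ξ₃) ∈ ℝ³ with ξ ≠ 0. With λ₁ = −ε^α|ξ_h|² + iξ₃/ε, λ₂ = −ε^α|ξ_h|² − iξ₃/ε, λ₃ = −ε^α|ξ_h|² + iξ₃A/ε, λ₄ = −ε^α|ξ_h|² − iξ₃A/ε, λ₅ = −ε^α|ξ_h|² + iξ₃B/ε, λ₆ = −ε^α|ξ_h|² − iξ₃B/ε, the following six identities hold: 𝔹(ξ,ε)W_i = λ_i W_i for i = 1,…,6, where W₁ = (0,0,1,0,0,−1), W₂ = (0,0,1,0,0,1), W₃ = (iAξ₃|ξ| + Aξ₁ξ₂, −A(ξ₁² + ξ₃²), −iAξ₁|ξ| + Aξ₂ξ₃, −iξ₃|ξ| − ξ₁ξ₂, ξ₁² + ξ₃², iξ₁|ξ| − ξ₂ξ₃), W₄ = (iAξ₃|ξ| − Aξ₁ξ₂, A(ξ₁² + ξ₃²), −iAξ₁|ξ| − Aξ₂ξ₃, iξ₃|ξ| − ξ₁ξ₂, ξ₁² + ξ₃², −iξ₁|ξ| − ξ₂ξ₃),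 W₅ = (−iBξ₃|ξ| + Bξ₁ξ₂, −B(ξ₁² + ξ₃²), iBξ₁|ξ| + Bξ₂ξ₃, iξ₃|ξ| − ξ₁ξ₂, ξ₁² + ξ₃², −iξ₁|ξ| − ξ₂ξ₃), W₆ = (−iBξ₃|ξ| − Bξ₁ξ₂, B(ξ₁² + ξ₃²), iBξ₁|ξ| − Bξ₂ξ₃, −iξ₃|ξ| − ξ₁ξ₂, ξ₁² + ξ₃², iξ₁|ξ| − ξ₂ξ₃), and A = (1 + √(4|ξ|² + 1))/(2|ξ|), B = (−1 + √(4|ξ|² + 1))/(2|ξ|). -/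

import Mathlib

/- Eigenvectors of the linearized rotating MHD symbol: `𝔹(ξ,ε) W_i = λ_i W_i` for i = 1,…,6. -/

open Real
noncomputable section

/-- `A = (1 + √(4|ξ|² + 1))/(2|ξ|)`. -/
def Aval (ξ₁ ξ₂ ξ₃ : ℝ) : ℝ :=
  (1 + Real.sqrt (4 * (ξ₁^2 + ξ₂^2 + ξ₃^2) + 1)) / (2 * Real.sqrt (ξ₁^2 + ξ₂^2 + ξ₃^2))

/-- `B = (-1 + √(4|ξ|² + 1))/(2|ξ|)`. -/
def Bval (ξ₁ ξ₂ ξ₃ : ℝ) : ℝ :=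
  (-1 + Real.sqrt (4 * (ξ₁^2 + ξ₂^2 + ξ₃^2) + 1)) / (2 * Real.sqrt (ξ₁^2 + ξ₂^2 + ξ₃^2))

/-- the eigenvalue `-ε^α |ξ_h|² + i ξ₃ c / ε`. -/
def lamMHD (ε α ξ₁ ξ₂ ξ₃ c : ℝ) : ℂ :=
  -(((ε ^ α * (ξ₁^2 + ξ₂^2)) : ℝ) : ℂ) + Complex.I * ((ξ₃ * c / ε : ℝ) : ℂ)

/-- the matrix `𝔹(ξ,ε)` of the linearized rotating MHD system on the Fourier side. -/
def Bmat (ε α ξ₁ ξ₂ ξ₃ : ℝ) : Matrix (Fin 6) (Fin 6) ℂ :=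
  let m : ℂ := ((ε ^ α * (ξ₁^2 + ξ₂^2) : ℝ) : ℂ)
  let N : ℝ := ξ₁^2 + ξ₂^2 + ξ₃^2
  let c : ℂ := Complex.I * ((ξ₃ / ε : ℝ) : ℂ)
  !![ -m + ((ξ₁*ξ₂/(ε*N) : ℝ) : ℂ), (((ξ₂^2+ξ₃^2)/(ε*N) : ℝ) : ℂ), 0, -c, 0, 0 ;
      -((((ξ₁^2+ξ₃^2)/(ε*N)) : ℝ) : ℂ), -m - ((ξ₁*ξ₂/(ε*N) : ℝ) : ℂ), 0, 0, -c, 0 ;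
      ((ξ₂*ξ₃/(ε*N) : ℝ) : ℂ), -(((ξ₁*ξ₃/(ε*N)) : ℝ) : ℂ), -m, 0, 0, -c ;
      -c, 0, 0, -m, 0, 0 ;
      0, -c, 0, 0, -m, 0 ;
      0, 0, -c, 0, 0, -m ]

/-- `W₁`. -/
def W1 : Fin 6 → ℂ := ![0, 0, 1, 0, 0, -1]

/-- `W₂`. -/
def W2 : Fin 6 → ℂ := ![0, 0, 1, 0, 0, 1]

/-- `W₃`. -/
def W3 (ξ₁ ξ₂ ξ₃ : ℝ) : Fin 6 → ℂ :=
  let A := Aval ξ₁ ξ₂ ξ₃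
  let nr := Real.sqrt (ξ₁^2 + ξ₂^2 + ξ₃^2)
  ![ Complex.I * ((A*ξ₃*nr : ℝ) : ℂ) + ((A*ξ₁*ξ₂ : ℝ) : ℂ),
     -((A*(ξ₁^2+ξ₃^2) : ℝ) : ℂ),
     -Complex.I * ((A*ξ₁*nr : ℝ) : ℂ) + ((A*ξ₂*ξ₃ : ℝ) : ℂ),
     -Complex.I * ((ξ₃*nr : ℝ) : ℂ) - ((ξ₁*ξ₂ : ℝ) : ℂ),
     ((ξ₁^2+ξ₃^2 : ℝ) : ℂ),
     Complex.I * ((ξ₁*nr : ℝ) : ℂ) - ((ξ₂*ξ₃ : ℝ) : ℂ) ]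

/-- `W₄`. -/
def W4 (ξ₁ ξ₂ ξ₃ : ℝ) : Fin 6 → ℂ :=
  let A := Aval ξ₁ ξ₂ ξ₃
  let nr := Real.sqrt (ξ₁^2 + ξ₂^2 + ξ₃^2)
  ![ Complex.I * ((A*ξ₃*nr : ℝ) : ℂ) - ((A*ξ₁*ξ₂ : ℝ) : ℂ),
     ((A*(ξ₁^2+ξ₃^2) : ℝ) : ℂ),
     -Complex.I * ((A*ξ₁*nr : ℝ) : ℂ) - ((A*ξ₂*ξ₃ : ℝ) : ℂ),
     Complex.I * ((ξ₃*nr : ℝ) : ℂ) - ((ξ₁*ξ₂ : ℝ) : ℂ),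
     ((ξ₁^2+ξ₃^2 : ℝ) : ℂ),
     -Complex.I * ((ξ₁*nr : ℝ) : ℂ) - ((ξ₂*ξ₃ : ℝ) : ℂ) ]

/-- `W₅`. -/
def W5 (ξ₁ ξ₂ ξ₃ : ℝ) : Fin 6 → ℂ :=
  let B := Bval ξ₁ ξ₂ ξ₃
  let nr := Real.sqrt (ξ₁^2 + ξ₂^2 + ξ₃^2)
  ![ -Complex.I * ((B*ξ₃*nr : ℝ) : ℂ) + ((B*ξ₁*ξ₂ : ℝ) : ℂ),
     -((B*(ξ₁^2+ξ₃^2) : ℝ) : ℂ),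
     Complex.I * ((B*ξ₁*nr : ℝ) : ℂ) + ((B*ξ₂*ξ₃ : ℝ) : ℂ),
     Complex.I * ((ξ₃*nr : ℝ) : ℂ) - ((ξ₁*ξ₂ : ℝ) : ℂ),
     ((ξ₁^2+ξ₃^2 : ℝ) : ℂ),
     -Complex.I * ((ξ₁*nr : ℝ) : ℂ) - ((ξ₂*ξ₃ : ℝ) : ℂ) ]

/-- `W₆`. -/
def W6 (ξ₁ ξ₂ ξ₃ : ℝ) : Fin 6 → ℂ :=
  let B := Bval ξ₁ ξ₂ ξ₃
  let nr := Real.sqrt (ξ₁^2 + ξ₂^2 + ξ₃^2)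
  ![ -Complex.I * ((B*ξ₃*nr : ℝ) : ℂ) - ((B*ξ₁*ξ₂ : ℝ) : ℂ),
     ((B*(ξ₁^2+ξ₃^2) : ℝ) : ℂ),
     Complex.I * ((B*ξ₁*nr : ℝ) : ℂ) - ((B*ξ₂*ξ₃ : ℝ) : ℂ),
     -Complex.I * ((ξ₃*nr : ℝ) : ℂ) - ((ξ₁*ξ₂ : ℝ) : ℂ),
     ((ξ₁^2+ξ₃^2 : ℝ) : ℂ),
     Complex.I * ((ξ₁*nr : ℝ) : ℂ) - ((ξ₂*ξ₃ : ℝ) : ℂ) ]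

/-- The common form of `W₃, …, W₆`, with `n = ±|ξ|` and `κ ∈ {A, -A, B, -B}`. -/
def polarizedVec (ξ₁ ξ₂ ξ₃ n κ : ℝ) : Fin 6 → ℂ :=
  ![κ * (Complex.I * ξ₃ * n + ξ₁ * ξ₂), -(κ * (ξ₁ ^ 2 + ξ₃ ^ 2)),
    κ * (-Complex.I * ξ₁ * n + ξ₂ * ξ₃), -(Complex.I * ξ₃ * n + ξ₁ * ξ₂), ξ₁ ^ 2 + ξ₃ ^ 2,
    -(-Complex.I * ξ₁ * n + ξ₂ * ξ₃)]

theorem Bmat_mulVec_polarizedVec {ε α ξ₁ ξ₂ ξ₃ n κ : ℝ} (hε : ε ≠ 0) (hn : n ≠ 0)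
    (hN : n ^ 2 = ξ₁ ^ 2 + ξ₂ ^ 2 + ξ₃ ^ 2) (hκ : κ ^ 2 * n = κ + n) :
    (Bmat ε α ξ₁ ξ₂ ξ₃).mulVec (polarizedVec ξ₁ ξ₂ ξ₃ n κ) =
      lamMHD ε α ξ₁ ξ₂ ξ₃ κ • polarizedVec ξ₁ ξ₂ ξ₃ n κ := by
  have hεc : (ε : ℂ) ≠ 0 := by exact_mod_cast hε
  have hnc : (n : ℂ) ≠ 0 := by exact_mod_cast hn
  have hNc : (n : ℂ) ^ 2 = ξ₁ ^ 2 + ξ₂ ^ 2 + ξ₃ ^ 2 := by exact_mod_cast hN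
  have hκc : (κ : ℂ) ^ 2 * n = κ + n := by exact_mod_cast hκ
  have hI := Complex.I_sq
  ext i
  fin_cases i <;>
    simp [Bmat, lamMHD, polarizedVec, Matrix.mulVec, dotProduct, Fin.sum_univ_six] <;>
    (try simp only [← hNc]) <;> field_simp
  · linear_combination (-(n * Complex.I * ξ₃ * (Complex.I * ξ₃ * n + ξ₁ * ξ₂))) * hκc +
      κ * ξ₃ ^ 2 * hNc - κ * ξ₃ ^ 2 * n ^ 2 * hI
  · linear_combination ((ξ₁ ^ 2 + ξ₃ ^ 2) * ξ₃ * n * Complex.I) * hκc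
  · linear_combination (-(n * Complex.I * ξ₃ * (-Complex.I * ξ₁ * n + ξ₂ * ξ₃))) * hκc -
      κ * ξ₁ * ξ₃ * hNc + κ * ξ₁ * ξ₃ * n ^ 2 * hI
  all_goals ring

theorem Aval_sq_mul {ξ₁ ξ₂ ξ₃ : ℝ} (h : √(ξ₁ ^ 2 + ξ₂ ^ 2 + ξ₃ ^ 2) ≠ 0) :
    Aval ξ₁ ξ₂ ξ₃ ^ 2 * √(ξ₁ ^ 2 + ξ₂ ^ 2 + ξ₃ ^ 2) =
      Aval ξ₁ ξ₂ ξ₃ + √(ξ₁ ^ 2 + ξ₂ ^ 2 + ξ₃ ^ 2) := by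
  have hN : √(ξ₁ ^ 2 + ξ₂ ^ 2 + ξ₃ ^ 2) ^ 2 = ξ₁ ^ 2 + ξ₂ ^ 2 + ξ₃ ^ 2 :=
    Real.sq_sqrt (by positivity)
  have hD : √(4 * (ξ₁ ^ 2 + ξ₂ ^ 2 + ξ₃ ^ 2) + 1) ^ 2 = 4 * (ξ₁ ^ 2 + ξ₂ ^ 2 + ξ₃ ^ 2) + 1 :=
    Real.sq_sqrt (by positivity)
  unfold Aval
  field_simp
  linear_combination hD - 4 * hN

theorem Bval_sq_mul {ξ₁ ξ₂ ξ₃ : ℝ} (h : √(ξ₁ ^ 2 + ξ₂ ^ 2 + ξ₃ ^ 2) ≠ 0) :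
    Bval ξ₁ ξ₂ ξ₃ ^ 2 * √(ξ₁ ^ 2 + ξ₂ ^ 2 + ξ₃ ^ 2) =
      -Bval ξ₁ ξ₂ ξ₃ + √(ξ₁ ^ 2 + ξ₂ ^ 2 + ξ₃ ^ 2) := by
  have hN : √(ξ₁ ^ 2 + ξ₂ ^ 2 + ξ₃ ^ 2) ^ 2 = ξ₁ ^ 2 + ξ₂ ^ 2 + ξ₃ ^ 2 :=
    Real.sq_sqrt (by positivity)
  have hD : √(4 * (ξ₁ ^ 2 + ξ₂ ^ 2 + ξ₃ ^ 2) + 1) ^ 2 = 4 * (ξ₁ ^ 2 + ξ₂ ^ 2 + ξ₃ ^ 2) + 1 :=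
    Real.sq_sqrt (by positivity)
  unfold Bval
  field_simp
  linear_combination hD - 4 * hN

theorem eigenvectors_linearized_MHD_symbol (ε α ξ₁ ξ₂ ξ₃ : ℝ) (hε : 0 < ε)
    (hξ : ¬(ξ₁ = 0 ∧ ξ₂ = 0 ∧ ξ₃ = 0)) :
    (Bmat ε α ξ₁ ξ₂ ξ₃).mulVec W1 = lamMHD ε α ξ₁ ξ₂ ξ₃ 1 • W1 ∧
    (Bmat ε α ξ₁ ξ₂ ξ₃).mulVec W2 = lamMHD ε α ξ₁ ξ₂ ξ₃ (-1) • W2 ∧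
    (Bmat ε α ξ₁ ξ₂ ξ₃).mulVec (W3 ξ₁ ξ₂ ξ₃) =
      lamMHD ε α ξ₁ ξ₂ ξ₃ (Aval ξ₁ ξ₂ ξ₃) • W3 ξ₁ ξ₂ ξ₃ ∧
    (Bmat ε α ξ₁ ξ₂ ξ₃).mulVec (W4 ξ₁ ξ₂ ξ₃) =
      lamMHD ε α ξ₁ ξ₂ ξ₃ (-(Aval ξ₁ ξ₂ ξ₃)) • W4 ξ₁ ξ₂ ξ₃ ∧
    (Bmat ε α ξ₁ ξ₂ ξ₃).mulVec (W5 ξ₁ ξ₂ ξ₃) =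
      lamMHD ε α ξ₁ ξ₂ ξ₃ (Bval ξ₁ ξ₂ ξ₃) • W5 ξ₁ ξ₂ ξ₃ ∧
    (Bmat ε α ξ₁ ξ₂ ξ₃).mulVec (W6 ξ₁ ξ₂ ξ₃) =
      lamMHD ε α ξ₁ ξ₂ ξ₃ (-(Bval ξ₁ ξ₂ ξ₃)) • W6 ξ₁ ξ₂ ξ₃ := by
  have hn : √(ξ₁ ^ 2 + ξ₂ ^ 2 + ξ₃ ^ 2) ≠ 0 := by
    refine fun h => hξ ?_
    rw [Real.sqrt_eq_zero (by positivity)] at h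
    refine ⟨?_, ?_, ?_⟩ <;> nlinarith [sq_nonneg ξ₁, sq_nonneg ξ₂, sq_nonneg ξ₃]
  have hN : √(ξ₁ ^ 2 + ξ₂ ^ 2 + ξ₃ ^ 2) ^ 2 = ξ₁ ^ 2 + ξ₂ ^ 2 + ξ₃ ^ 2 :=
    Real.sq_sqrt (by positivity)
  have hA := Aval_sq_mul hn
  have hB := Bval_sq_mul hn
  have h3 : W3 ξ₁ ξ₂ ξ₃ = polarizedVec ξ₁ ξ₂ ξ₃ (√(ξ₁ ^ 2 + ξ₂ ^ 2 + ξ₃ ^ 2)) (Aval ξ₁ ξ₂ ξ₃) := by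
    ext i; fin_cases i <;> simp [W3, polarizedVec] <;> ring
  have h4 : W4 ξ₁ ξ₂ ξ₃ =
      polarizedVec ξ₁ ξ₂ ξ₃ (-√(ξ₁ ^ 2 + ξ₂ ^ 2 + ξ₃ ^ 2)) (-Aval ξ₁ ξ₂ ξ₃) := by
    ext i; fin_cases i <;> simp [W4, polarizedVec] <;> ring
  have h5 : W5 ξ₁ ξ₂ ξ₃ = polarizedVec ξ₁ ξ₂ ξ₃ (-√(ξ₁ ^ 2 + ξ₂ ^ 2 + ξ₃ ^ 2)) (Bval ξ₁ ξ₂ ξ₃) := by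
    ext i; fin_cases i <;> simp [W5, polarizedVec] <;> ring
  have h6 : W6 ξ₁ ξ₂ ξ₃ = polarizedVec ξ₁ ξ₂ ξ₃ (√(ξ₁ ^ 2 + ξ₂ ^ 2 + ξ₃ ^ 2)) (-Bval ξ₁ ξ₂ ξ₃) := by
    ext i; fin_cases i <;> simp [W6, polarizedVec] <;> ring
  rw [h3, h4, h5, h6]
  refine ⟨?_, ?_,
    Bmat_mulVec_polarizedVec hε.ne' hn hN hA,
    Bmat_mulVec_polarizedVec hε.ne' (neg_ne_zero.2 hn) (by rw [neg_sq, hN])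
      (by linear_combination -hA),
    Bmat_mulVec_polarizedVec hε.ne' (neg_ne_zero.2 hn) (by rw [neg_sq, hN])
      (by linear_combination -hB),
    Bmat_mulVec_polarizedVec hε.ne' hn hN (by linear_combination hB)⟩ <;>
  · ext i
    fin_cases i <;>
      simp [Bmat, lamMHD, W1, W2, Matrix.mulVec, dotProduct, Fin.sum_univ_six] <;> ring
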